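/- arXiv:1901.08907 — 3 statements merged into one kernel-verified Lean document; each statement's English description precedes it below -/
import Mathlib

section
/- Let d ≥ 1 and work in the ring of multivariate polynomials over ℝ in 2d variables X_1,…,X_d (item variables) and Y_1,…,Y_d (entity variables). Define polynomial vectors v_0 = (X_1,…,X_d) and e_0 = (Y_1,…,Y_d), and for each l ≥ 0 choose real weight vectors w_l^{VV}, w_l^{EV}, w_l^{VE}, w_l^{EE} ∈ ℝ^d and real bias vectors b_l^V, b_l^E ∈ ℝ^d, and define recursively (v_{l+1})_k = (v_l)_k · Σ_{i=1}^d (e_l)_i w_l^{VV(i)} + (e_l)_k · Σ_{i=1}^d (v_l)_i w_l^{EV(i)} + b_l^{V(k)} and (e_{l+1})_k = (v_l)_k · Σ_{i=1}^d (e_l)_i w_l^{VE(i)} + (e_l)_k · Σ_{i=1}^d (v_l)_i w_l^{EE(i)} + b_l^{E(k)} for k = 1,…,d. Then for every L ≥ 1 and every k, every monomial appearing with nonzero coefficient in the polynomial (v_L)_k has total degree in the variables X_1,…,X_d at most 2^{L-1} and total degree in the variables Y_1,…,Y_d at most 2^{L-1}; the same bounds hold for every entry of e_L. -/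
open MvPolynomial

section RestrictSupport

variable {σ R : Type*} [CommSemiring R] (φ : (σ →₀ ℕ) →+ ℕ)

theorem mul_mem_restrictSupport_le {a b : ℕ} {p q : MvPolynomial σ R}
    (hp : p ∈ restrictSupport R {m | φ m ≤ a}) (hq : q ∈ restrictSupport R {m | φ m ≤ b}) :
    p * q ∈ restrictSupport R {m | φ m ≤ a + b} := by
  classical
  intro m hm
  obtain ⟨m₁, h₁, m₂, h₂, rfl⟩ := Finset.mem_add.mp (support_mul p q hm)
  rw [Set.mem_ofPred_eq, map_add]
  exact add_le_add (hp h₁) (hq h₂)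

theorem C_mem_restrictSupport_le (a : ℕ) (r : R) :
    (C r : MvPolynomial σ R) ∈ restrictSupport R {m | φ m ≤ a} :=
  (monomial_mem_restrictSupport R).mpr (Or.inl (by simp))

theorem X_mem_restrictSupport_le {a : ℕ} {i : σ} (h : φ (Finsupp.single i 1) ≤ a) :
    (X i : MvPolynomial σ R) ∈ restrictSupport R {m | φ m ≤ a} :=
  (monomial_mem_restrictSupport R).mpr (Or.inl h)

theorem sum_mul_C_mem_restrictSupport_le {ι : Type*} [Fintype ι] {a : ℕ}
    {p : ι → MvPolynomial σ R} (hp : ∀ i, p i ∈ restrictSupport R {m | φ m ≤ a}) (w : ι → R) :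
    ∑ i, p i * C (w i) ∈ restrictSupport R {m | φ m ≤ a} :=
  Submodule.sum_mem _ fun i _ =>
    mul_mem_restrictSupport_le φ (hp i) (C_mem_restrictSupport_le φ 0 (w i))

/-- One output of a cross&compress unit has degree at most the sum of the degrees of its inputs. -/
theorem cross_compress_mem_restrictSupport_le {ι : Type*} [Fintype ι] {a b : ℕ}
    {v e : ι → MvPolynomial σ R} (hv : ∀ i, v i ∈ restrictSupport R {m | φ m ≤ a})
    (he : ∀ i, e i ∈ restrictSupport R {m | φ m ≤ b}) (w w' : ι → R) (r : R) (k : ι) :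
    v k * (∑ i, e i * C (w i)) + e k * (∑ i, v i * C (w' i)) + C r ∈
      restrictSupport R {m | φ m ≤ a + b} :=
  add_mem
    (add_mem (mul_mem_restrictSupport_le φ (hv k) (sum_mul_C_mem_restrictSupport_le φ he w))
      (add_comm b a ▸
        mul_mem_restrictSupport_le φ (he k) (sum_mul_C_mem_restrictSupport_le φ hv w')))
    (C_mem_restrictSupport_le φ _ r)

theorem iterated_cross_compress_mem_restrictSupport_le {ι : Type*} [Fintype ι]
    {wVV wEV wVE wEE bV bE : ℕ → ι → R} {v e : ℕ → ι → MvPolynomial σ R}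
    (hv : ∀ l k, v (l + 1) k =
      v l k * (∑ i, e l i * C (wVV l i)) + e l k * (∑ i, v l i * C (wEV l i)) + C (bV l k))
    (he : ∀ l k, e (l + 1) k =
      v l k * (∑ i, e l i * C (wVE l i)) + e l k * (∑ i, v l i * C (wEE l i)) + C (bE l k))
    {a b : ℕ} (hv0 : ∀ k, v 0 k ∈ restrictSupport R {m | φ m ≤ a})
    (he0 : ∀ k, e 0 k ∈ restrictSupport R {m | φ m ≤ b}) (l : ℕ) :
    (∀ k, v (l + 1) k ∈ restrictSupport R {m | φ m ≤ 2 ^ l * (a + b)}) ∧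
      ∀ k, e (l + 1) k ∈ restrictSupport R {m | φ m ≤ 2 ^ l * (a + b)} := by
  induction l with
  | zero =>
    simp only [hv 0, he 0, pow_zero, one_mul]
    exact ⟨fun k => cross_compress_mem_restrictSupport_le φ hv0 he0 _ _ _ k,
      fun k => cross_compress_mem_restrictSupport_le φ hv0 he0 _ _ _ k⟩
  | succ l ih =>
    simp only [hv (l + 1), he (l + 1), pow_succ, mul_two, add_mul]
    exact ⟨fun k => cross_compress_mem_restrictSupport_le φ ih.1 ih.2 _ _ _ k,
      fun k => cross_compress_mem_restrictSupport_le φ ih.1 ih.2 _ _ _ k⟩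

end RestrictSupport

/-- Theorem 1 (degree upper bound part) of the MKR paper: after `L ≥ 1` layers of the
cross&compress recursion, every monomial of every entry of `v L` and `e L` has total degree
at most `2^(L-1)` in the item variables `X₁,…,X_d` (encoded as `Sum.inl`) and at most
`2^(L-1)` in the entity variables `Y₁,…,Y_d` (encoded as `Sum.inr`). -/
theorem mkr_cross_compress_degree_bound (d : ℕ) (hd : 1 ≤ d)
    (wVV wEV wVE wEE bV bE : ℕ → Fin d → ℝ)
    (v e : ℕ → Fin d → MvPolynomial (Fin d ⊕ Fin d) ℝ)
    (hv0 : ∀ k, v 0 k = X (Sum.inl k))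
    (he0 : ∀ k, e 0 k = X (Sum.inr k))
    (hv : ∀ l k, v (l + 1) k =
      v l k * (∑ i, e l i * C (wVV l i)) + e l k * (∑ i, v l i * C (wEV l i)) + C (bV l k))
    (he : ∀ l k, e (l + 1) k =
      v l k * (∑ i, e l i * C (wVE l i)) + e l k * (∑ i, v l i * C (wEE l i)) + C (bE l k))
    (L : ℕ) (hL : 1 ≤ L) (k : Fin d) :
    (∀ m ∈ (v L k).support,
      (∑ i, m (Sum.inl i)) ≤ 2 ^ (L - 1) ∧ (∑ i, m (Sum.inr i)) ≤ 2 ^ (L - 1)) ∧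
    (∀ m ∈ (e L k).support,
      (∑ i, m (Sum.inl i)) ≤ 2 ^ (L - 1) ∧ (∑ i, m (Sum.inr i)) ≤ 2 ^ (L - 1)) := by
  obtain ⟨l, rfl⟩ := Nat.exists_eq_add_of_le' hL
  let φ : (Fin d ⊕ Fin d →₀ ℕ) →+ ℕ := ∑ i, Finsupp.applyAddHom (Sum.inl i)
  let ψ : (Fin d ⊕ Fin d →₀ ℕ) →+ ℕ := ∑ i, Finsupp.applyAddHom (Sum.inr i)
  have hφ (m) : φ m = ∑ i, m (Sum.inl i) := by simp [φ]
  have hψ (m) : ψ m = ∑ i, m (Sum.inr i) := by simp [ψ]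
  have hitem := iterated_cross_compress_mem_restrictSupport_le φ hv he (a := 1) (b := 0)
    (fun k => hv0 k ▸ X_mem_restrictSupport_le φ (by simp [hφ, Finsupp.single_apply]))
    (fun k => he0 k ▸ X_mem_restrictSupport_le φ (by simp [hφ])) l
  have hentity := iterated_cross_compress_mem_restrictSupport_le ψ hv he (a := 0) (b := 1)
    (fun k => hv0 k ▸ X_mem_restrictSupport_le ψ (by simp [hψ]))
    (fun k => he0 k ▸ X_mem_restrictSupport_le ψ (by simp [hψ, Finsupp.single_apply])) l
  simp only [add_zero, zero_add, mul_one, hφ, hψ] at hitem hentity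
  exact ⟨fun m hm => ⟨hitem.1 k hm, hentity.1 k hm⟩, fun m hm => ⟨hitem.2 k hm, hentity.2 k hm⟩⟩
end

section
/- Let d ≥ 1 and work in the ring of multivariate polynomials over ℝ in 2d variables X_1,…,X_d (item variables) and Y_1,…,Y_d (entity variables). Define v_0 = (X_1,…,X_d), e_0 = (Y_1,…,Y_d), and for each l ≥ 0 define (v_{l+1})_k = (v_l)_k · Σ_{i=1}^d (e_l)_i + (e_l)_k · Σ_{i=1}^d (v_l)_i and (e_{l+1})_k = (v_l)_k · Σ_{i=1}^d (e_l)_i + (e_l)_k · Σ_{i=1}^d (v_l)_i (i.e., the cross&compress recursion with all weight vectors equal to the all-ones vector and all biases zero). Then for every L ≥ 1 and every k, the polynomial (v_L)_k contains a monomial with nonzero coefficient whose total degree in X_1,…,X_d equals exactly 2^{L-1} and whose total degree in Y_1,…,Y_d equals exactly 2^{L-1}. -/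
open MvPolynomial

/-- The bidegree weight: the left variables have weight `(1, 0)`, the right ones `(0, 1)`. -/
def bidegreeWeight (α β : Type*) : α ⊕ β → ℕ × ℕ :=
  Sum.elim (fun _ => (1, 0)) (fun _ => (0, 1))

lemma weight_bidegreeWeight {α β : Type*} [Fintype α] [Fintype β] (m : α ⊕ β →₀ ℕ) :
    Finsupp.weight (bidegreeWeight α β) m = (∑ i, m (Sum.inl i), ∑ j, m (Sum.inr j)) := by
  rw [Finsupp.weight_apply, Finsupp.sum_fintype _ _ (by simp), Fintype.sum_sum_type]
  ext <;> simp [bidegreeWeight, Prod.fst_sum, Prod.snd_sum]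

section CrossCompress

variable {ι σ R M : Type*} [Fintype ι] [CommSemiring R] [AddCommMonoid M]

lemma isWeightedHomogeneous_crossCompress {w : σ → M} {a b : M} {v e : ι → MvPolynomial σ R}
    (hv : ∀ k, IsWeightedHomogeneous w (v k) a) (he : ∀ k, IsWeightedHomogeneous w (e k) b)
    (k : ι) :
    IsWeightedHomogeneous w (v k * (∑ i, e i) + e k * (∑ i, v i)) (a + b) :=
  ((hv k).mul (.sum _ _ _ fun i _ => he i)).add
    (add_comm b a ▸ (he k).mul (.sum _ _ _ fun i _ => hv i))

lemma eval_crossCompress_pos {x : σ → ℝ} {v e : ι → MvPolynomial σ ℝ}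
    (hv : ∀ k, 0 < eval x (v k)) (he : ∀ k, 0 < eval x (e k)) (k : ι) :
    0 < eval x (v k * (∑ i, e i) + e k * (∑ i, v i)) := by
  have hsum {f : ι → MvPolynomial σ ℝ} (hf : ∀ k, 0 < eval x (f k)) :
      0 < ∑ i, eval x (f i) :=
    Finset.sum_pos (fun i _ => hf i) ⟨k, Finset.mem_univ k⟩
  simp only [map_add, map_mul, map_sum]
  exact add_pos (mul_pos (hv k) (hsum he)) (mul_pos (he k) (hsum hv))

end CrossCompress

/-- Theorem 1 (attainment part) of the MKR paper: with all-ones weights and zero biases,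
after `L ≥ 1` layers each entry of `v L` contains a monomial with nonzero coefficient whose
total degree in the item variables `X₁,…,X_d` (encoded `Sum.inl`) is exactly `2^(L-1)` and
whose total degree in the entity variables `Y₁,…,Y_d` (encoded `Sum.inr`) is exactly
`2^(L-1)`. -/
theorem mkr_cross_compress_degree_attained (d : ℕ) (hd : 1 ≤ d)
    (v e : ℕ → Fin d → MvPolynomial (Fin d ⊕ Fin d) ℝ)
    (hv0 : ∀ k, v 0 k = X (Sum.inl k))
    (he0 : ∀ k, e 0 k = X (Sum.inr k))
    (hv : ∀ l k, v (l + 1) k = v l k * (∑ i, e l i) + e l k * (∑ i, v l i))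
    (he : ∀ l k, e (l + 1) k = v l k * (∑ i, e l i) + e l k * (∑ i, v l i))
    (L : ℕ) (hL : 1 ≤ L) (k : Fin d) :
    ∃ m ∈ (v L k).support,
      (∑ i, m (Sum.inl i)) = 2 ^ (L - 1) ∧ (∑ i, m (Sum.inr i)) = 2 ^ (L - 1) := by
  have hpos (l : ℕ) : (∀ k, 0 < eval 1 (v l k)) ∧ ∀ k, 0 < eval 1 (e l k) := by
    induction l with
    | zero => simp [hv0, he0]
    | succ l ih =>
      simp only [hv, he, and_self]
      exact eval_crossCompress_pos ih.1 ih.2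
  have hhom (l : ℕ) :
      (∀ k, IsWeightedHomogeneous (bidegreeWeight (Fin d) (Fin d)) (v (l + 1) k)
        (2 ^ l, 2 ^ l)) ∧
      ∀ k, IsWeightedHomogeneous (bidegreeWeight (Fin d) (Fin d)) (e (l + 1) k)
        (2 ^ l, 2 ^ l) := by
    induction l with
    | zero =>
      simp only [hv, he, hv0, he0, and_self]
      exact isWeightedHomogeneous_crossCompress
        (fun i => isWeightedHomogeneous_X ℝ (bidegreeWeight (Fin d) (Fin d)) (Sum.inl i))
        (fun i => isWeightedHomogeneous_X ℝ (bidegreeWeight (Fin d) (Fin d)) (Sum.inr i))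
    | succ l ih =>
      simp only [hv _, he _, and_self] at ih ⊢
      have hdeg : ((2 ^ (l + 1), 2 ^ (l + 1)) : ℕ × ℕ) = (2 ^ l, 2 ^ l) + (2 ^ l, 2 ^ l) := by
        simp [pow_succ, mul_two]
      rw [hdeg]
      exact isWeightedHomogeneous_crossCompress ih ih
  obtain ⟨l, rfl⟩ := Nat.exists_eq_add_of_le' hL
  have hne : v (l + 1) k ≠ 0 := fun h => by simpa [h] using (hpos (l + 1)).1 k
  obtain ⟨m, hm⟩ := support_nonempty.mpr hne
  refine ⟨m, hm, ?_⟩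
  have hw := (hhom l).1 k (mem_support_iff.mp hm)
  rw [weight_bidegreeWeight] at hw
  simpa using hw
end

section
/- Let d ≥ 1 and work in the ring of multivariate polynomials over ℝ in 2d variables X_1,…,X_d (item variables) and Y_1,…,Y_d (entity variables). Define v_0 = (X_1,…,X_d), e_0 = (Y_1,…,Y_d), and for each l ≥ 0 choose real weight vectors w_l^{EV}, w_l^{VE} ∈ ℝ^d and real bias vectors b_l^V, b_l^E ∈ ℝ^d, and define recursively (v_{l+1})_k = (e_0)_k · Σ_{i=1}^d (v_l)_i w_l^{EV(i)} + (v_l)_k + b_l^{V(k)} and (e_{l+1})_k = (v_0)_k · Σ_{i=1}^d (e_l)_i w_l^{VE(i)} + (e_l)_k + b_l^{E(k)}. Then for every l ≥ 0 and every k, every monomial appearing with nonzero coefficient in (v_l)_k has total degree at most 1 in the variables X_1,…,X_d and total degree at most l in the variables Y_1,…,Y_d (hence total degree at most l + 1), and symmetrically every monomial of every entry of e_l has total degree at most 1 in Y_1,…,Y_d and at most l in X_1,…,X_d. -/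
open MvPolynomial

/-- Degree bounds for a recursion `p (l + 1) k = Y k * ∑ i, p l i * w l i + p l k + b l k` started
at `p 0 k = X k`, with respect to two additive degree functions `f` and `g` on exponents. -/
theorem MvPolynomial.degree_le_of_cross_recursion {ι σ R : Type*} [Fintype ι] [CommSemiring R]
    (f g : (σ →₀ ℕ) →+ ℕ) (x y : ι → σ)
    (hfx : ∀ k, f (Finsupp.single (x k) 1) ≤ 1) (hgx : ∀ k, g (Finsupp.single (x k) 1) = 0)
    (hfy : ∀ k, f (Finsupp.single (y k) 1) = 0) (hgy : ∀ k, g (Finsupp.single (y k) 1) ≤ 1)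
    (w b : ℕ → ι → R) (p : ℕ → ι → MvPolynomial σ R)
    (h0 : ∀ k, p 0 k = X (x k))
    (hp : ∀ l k, p (l + 1) k = X (y k) * (∑ i, p l i * C (w l i)) + p l k + C (b l k))
    (l : ℕ) (k : ι) :
    ∀ m ∈ (p l k).support, f m ≤ 1 ∧ g m ≤ l := by
  classical
  induction l generalizing k with
  | zero =>
    intro m hm
    rw [h0] at hm
    have hm' := Finset.mem_singleton.1 (support_monomial_subset hm)
    subst hm'
    exact ⟨hfx k, (hgx k).le⟩
  | succ l ih =>
    intro m hm
    rw [hp] at hm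
    rcases Finset.mem_union.1 (support_add hm) with hm | hm
    · rcases Finset.mem_union.1 (support_add hm) with hm | hm
      · rw [support_X_mul] at hm
        obtain ⟨n, hn, rfl⟩ := Finset.mem_map.1 hm
        obtain ⟨i, -, hi⟩ := Finset.mem_biUnion.1 (support_sum hn)
        rw [mul_comm, ← smul_eq_C_mul] at hi
        obtain ⟨hf, hg⟩ := ih i n (support_smul hi)
        have := hfy k
        have := hgy k
        simp only [addLeftEmbedding_apply, map_add]
        omega
      · exact ⟨(ih k m hm).1, (ih k m hm).2.trans l.le_succ⟩
    · have hm' := Finset.mem_singleton.1 (support_monomial_subset hm)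
      subst hm'
      simp

/-- The claim after Proposition 2 of the MKR paper: for the DCN-equivalent version of the
cross&compress recursion, every monomial of every entry of `v l` has degree at most `1` in
the item variables `X₁,…,X_d` (encoded `Sum.inl`) and at most `l` in the entity variables
`Y₁,…,Y_d` (encoded `Sum.inr`), hence total degree at most `l + 1`; symmetrically for `e l`.
So its polynomial approximation ability is only `O(l)`. -/
theorem mkr_dcn_degree_bound (d : ℕ) (hd : 1 ≤ d)
    (wEV wVE bV bE : ℕ → Fin d → ℝ)
    (v e : ℕ → Fin d → MvPolynomial (Fin d ⊕ Fin d) ℝ)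
    (hv0 : ∀ k, v 0 k = X (Sum.inl k))
    (he0 : ∀ k, e 0 k = X (Sum.inr k))
    (hv : ∀ l k, v (l + 1) k =
      X (Sum.inr k) * (∑ i, v l i * C (wEV l i)) + v l k + C (bV l k))
    (he : ∀ l k, e (l + 1) k =
      X (Sum.inl k) * (∑ i, e l i * C (wVE l i)) + e l k + C (bE l k)) :
    ∀ l k,
      (∀ m ∈ (v l k).support,
        (∑ i, m (Sum.inl i)) ≤ 1 ∧ (∑ i, m (Sum.inr i)) ≤ l ∧
        (∑ i, m (Sum.inl i)) + (∑ i, m (Sum.inr i)) ≤ l + 1) ∧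
      (∀ m ∈ (e l k).support,
        (∑ i, m (Sum.inr i)) ≤ 1 ∧ (∑ i, m (Sum.inl i)) ≤ l ∧
        (∑ i, m (Sum.inl i)) + (∑ i, m (Sum.inr i)) ≤ l + 1) := by
  let f : (Fin d ⊕ Fin d →₀ ℕ) →+ ℕ := ∑ i, Finsupp.applyAddHom (Sum.inl i)
  let g : (Fin d ⊕ Fin d →₀ ℕ) →+ ℕ := ∑ i, Finsupp.applyAddHom (Sum.inr i)
  have hf (m) : f m = ∑ i, m (Sum.inl i) := by simp [f]
  have hg (m) : g m = ∑ i, m (Sum.inr i) := by simp [g]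
  have hfl (k) : f (Finsupp.single (Sum.inl k) 1) = 1 := by simp [hf, Finsupp.single_apply]
  have hfr (k) : f (Finsupp.single (Sum.inr k) 1) = 0 := by simp [hf]
  have hgl (k) : g (Finsupp.single (Sum.inl k) 1) = 0 := by simp [hg]
  have hgr (k) : g (Finsupp.single (Sum.inr k) 1) = 1 := by simp [hg, Finsupp.single_apply]
  intro l k
  simp only [← hf, ← hg]
  constructor
  · intro m hm
    have := degree_le_of_cross_recursion f g Sum.inl Sum.inr (fun k => (hfl k).le) hgl hfr
      (fun k => (hgr k).le) wEV bV v hv0 hv l k m hm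
    omega
  · intro m hm
    have := degree_le_of_cross_recursion g f Sum.inr Sum.inl (fun k => (hgr k).le) hfr hgl
      (fun k => (hfl k).le) wVE bE e he0 he l k m hm
    omega
end
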